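/- Let σ_D, σ_E > 0. The secret-key capacity with amplitude constraint A converges, as A → ∞, to the secret-key capacity under an average power constraint: lim_{A → ∞} C_k(A) = (1/2) ln(1 + σ_E²/σ_D²). -/

import Mathlib

open MeasureTheory ProbabilityTheory Real Filter Set
open scoped Classical

noncomputable section

/-- Kullback–Leibler divergence of `μ` from `ν` (valued in `EReal`; `⊤` when undefined). -/
def klDiv {α : Type*} [MeasurableSpace α] (μ ν : Measure α) : EReal :=
  if μ ≪ ν ∧ Integrable (llr μ ν) μ then ((∫ x, llr μ ν x ∂μ : ℝ) : EReal) else ⊤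

/-- Mutual information `I(U;V)` under `P`: the KL divergence of the joint law of `(U,V)`
from the product of its marginal laws. -/
def mutualInfo {Ω α β : Type*} [MeasurableSpace Ω] [MeasurableSpace α] [MeasurableSpace β]
    (P : Measure Ω) (U : Ω → α) (V : Ω → β) : EReal :=
  klDiv (P.map (fun ω => (U ω, V ω))) ((P.map U).prod (P.map V))

/-- Joint law of `(X, N_D, N_E)` where `X ~ μ`, `N_D ~ N(0,σD²)`, `N_E ~ N(0,σE²)` are
mutually independent. -/
def chan (μ : Measure ℝ) (σD σE : ℝ) : Measure (ℝ × ℝ × ℝ) :=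
  μ.prod ((gaussianReal 0 (σD ^ 2).toNNReal).prod (gaussianReal 0 (σE ^ 2).toNNReal))

/-- The channel input `X`. -/
def Xc : ℝ × ℝ × ℝ → ℝ := fun ω => ω.1
/-- The legitimate receiver's observation `Y = X + N_D`. -/
def Yc : ℝ × ℝ × ℝ → ℝ := fun ω => ω.1 + ω.2.1
/-- The eavesdropper's observation `Z = X + N_E`. -/
def Zc : ℝ × ℝ × ℝ → ℝ := fun ω => ω.1 + ω.2.2

/-- The secret-key rate `I(X;(Y,Z)) − I(X;Z)` for input distribution `μ`. -/
def skRate (σD σE : ℝ) (μ : Measure ℝ) : EReal :=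
  mutualInfo (chan μ σD σE) Xc (fun ω => (Yc ω, Zc ω)) - mutualInfo (chan μ σD σE) Xc Zc

/-- Secret-key capacity with amplitude constraint `A`. -/
def Ck (σD σE A : ℝ) : EReal :=
  sSup {r : EReal | ∃ μ : Measure ℝ, IsProbabilityMeasure μ ∧ μ (Set.Icc (-A) A)ᶜ = 0 ∧
    r = skRate σD σE μ}

open scoped NNReal ENNReal

lemma klDiv_withDensity_of_integrable {α : Type*} [MeasurableSpace α] (ν : Measure α)
    [SigmaFinite ν] {f : α → ℝ} (hf : Measurable f) (hf0 : ∀ x, 0 ≤ f x)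
    (hint : Integrable (fun x => Real.log (f x)) (ν.withDensity fun x => ENNReal.ofReal (f x))) :
    klDiv (ν.withDensity fun x => ENNReal.ofReal (f x)) ν =
      ((∫ x, Real.log (f x) ∂(ν.withDensity fun x => ENNReal.ofReal (f x)) : ℝ) : EReal) := by
  have hac := withDensity_absolutelyContinuous ν fun x => ENNReal.ofReal (f x)
  have hllr : llr (ν.withDensity fun x => ENNReal.ofReal (f x)) ν
      =ᵐ[ν.withDensity fun x => ENNReal.ofReal (f x)] fun x => Real.log (f x) := by
    filter_upwards [hac.ae_le (Measure.rnDeriv_withDensity ν hf.ennreal_ofReal)] with x hx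
    simp only [llr_def]
    rw [hx, ENNReal.toReal_ofReal (hf0 x)]
  rw [klDiv, if_pos ⟨hac, hint.congr hllr.symm⟩, integral_congr_ae hllr]

lemma integral_log_le_of_lintegral_le_one {Ω β : Type*} [MeasurableSpace β] [MeasurableSpace Ω] (P : Measure Ω)
    [IsProbabilityMeasure P] (ν : Measure β) {V : Ω → β} (hV : Measurable V) {f g : β → ℝ}
    (hf : Measurable f) (hg : Measurable g) (hf0 : ∀ v, 0 < f v) (hg0 : ∀ v, 0 < g v)
    (hlaw : P.map V = ν.withDensity fun v => ENNReal.ofReal (f v))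
    (hg1 : ∫⁻ v, ENNReal.ofReal (g v) ∂ν ≤ 1)
    (hfi : Integrable (fun ω => Real.log (f (V ω))) P)
    (hgi : Integrable (fun ω => Real.log (g (V ω))) P) :
    ∫ ω, Real.log (g (V ω)) ∂P ≤ ∫ ω, Real.log (f (V ω)) ∂P := by
  have hr0 : ∀ ω, 0 ≤ g (V ω) / f (V ω) := fun ω => div_nonneg (hg0 _).le (hf0 _).le
  have hlin : ∫⁻ ω, ENNReal.ofReal (g (V ω) / f (V ω)) ∂P ≤ 1 := by
    calc ∫⁻ ω, ENNReal.ofReal (g (V ω) / f (V ω)) ∂P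
        = ∫⁻ v, ENNReal.ofReal (g v / f v) ∂(P.map V) := by
          rw [lintegral_map (by fun_prop) hV]
      _ = ∫⁻ v, ENNReal.ofReal (g v) ∂ν := by
          rw [hlaw, lintegral_withDensity_eq_lintegral_mul _ (by fun_prop) (by fun_prop)]
          refine lintegral_congr fun v => ?_
          rw [Pi.mul_apply, ← ENNReal.ofReal_mul (hf0 _).le, mul_div_cancel₀ _ (hf0 _).ne']
      _ ≤ 1 := hg1
  have hri : Integrable (fun ω => g (V ω) / f (V ω)) P := by
    refine ⟨Measurable.aestronglyMeasurable (by fun_prop), ?_⟩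
    rw [hasFiniteIntegral_iff_ofReal (ae_of_all _ hr0)]
    exact hlin.trans_lt ENNReal.one_lt_top
  have hr1 : ∫ ω, g (V ω) / f (V ω) ∂P ≤ 1 := by
    rw [integral_eq_lintegral_of_nonneg_ae (ae_of_all _ hr0) hri.aestronglyMeasurable]
    exact ENNReal.toReal_le_of_le_ofReal zero_le_one (by simpa using hlin)
  have key : ∫ ω, (Real.log (g (V ω)) - Real.log (f (V ω))) ∂P ≤
      ∫ ω, (g (V ω) / f (V ω) - 1) ∂P := by
    refine integral_mono (hgi.sub hfi) (hri.sub (integrable_const 1)) fun ω => ?_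
    simp only
    rw [← Real.log_div (hg0 _).ne' (hf0 _).ne']
    exact Real.log_le_sub_one_of_pos (div_pos (hg0 _) (hf0 _))
  rw [integral_sub hgi hfi, integral_sub hri (integrable_const 1)] at key
  simp only [integral_const, probReal_univ, smul_eq_mul, mul_one] at key
  linarith

section ShiftChannel

variable {β : Type*} [AddCommGroup β] [MeasurableSpace β] [MeasurableSub₂ β]

/-- The density of `ι X + N` when `X` has law `μ` and `N` has density `ψ`. -/
def mixDensity (μ : Measure ℝ) (ι : ℝ → β) (ψ : β → ℝ) (v : β) : ℝ :=
  ∫ x, ψ (v - ι x) ∂μ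

lemma measurable_mixDensity (μ : Measure ℝ) [SFinite μ] {ι : ℝ → β} (hι : Measurable ι)
    {ψ : β → ℝ} (hψ : Measurable ψ) : Measurable (mixDensity μ ι ψ) := by
  have h : Measurable (Function.uncurry fun (x : ℝ) (v : β) => ψ (v - ι x)) := by
    unfold Function.uncurry
    fun_prop
  exact (h.stronglyMeasurable.integral_prod_left (μ := μ)).measurable

lemma integrable_shift (μ : Measure ℝ) [IsProbabilityMeasure μ] {ι : ℝ → β}
    (hι : Measurable ι) {ψ : β → ℝ} (hψ : Measurable ψ) (hpos : ∀ n, 0 < ψ n) {C : ℝ}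
    (hC : ∀ n, ψ n ≤ C) (v : β) : Integrable (fun x => ψ (v - ι x)) μ := by
  refine Integrable.of_bound (C := C) (Measurable.aestronglyMeasurable (by fun_prop)) ?_
  refine ae_of_all _ fun x => ?_
  rw [Real.norm_of_nonneg (hpos _).le]
  exact hC _

lemma mixDensity_pos (μ : Measure ℝ) [IsProbabilityMeasure μ] {ι : ℝ → β}
    (hι : Measurable ι) {ψ : β → ℝ} (hψ : Measurable ψ) (hpos : ∀ n, 0 < ψ n) {C : ℝ}
    (hC : ∀ n, ψ n ≤ C) (v : β) : 0 < mixDensity μ ι ψ v := by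
  rw [mixDensity, integral_pos_iff_support_of_nonneg (fun x => (hpos _).le)
    (integrable_shift μ hι hψ hpos hC v)]
  have : Function.support (fun x => ψ (v - ι x)) = Set.univ := by
    ext x
    simp [(hpos _).ne']
  simp [this]

lemma mixDensity_le (μ : Measure ℝ) [IsProbabilityMeasure μ] {ι : ℝ → β}
    (hι : Measurable ι) {ψ : β → ℝ} (hψ : Measurable ψ) (hpos : ∀ n, 0 < ψ n) {C : ℝ}
    (hC : ∀ n, ψ n ≤ C) (v : β) : mixDensity μ ι ψ v ≤ C := by
  calc mixDensity μ ι ψ v ≤ ∫ _, C ∂μ :=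
        integral_mono (integrable_shift μ hι hψ hpos hC v) (integrable_const _) fun x => hC _
    _ = C := by simp

lemma le_mixDensity (μ : Measure ℝ) [IsProbabilityMeasure μ] {ι : ℝ → β}
    (hι : Measurable ι) {ψ : β → ℝ} (hψ : Measurable ψ) (hpos : ∀ n, 0 < ψ n) {C : ℝ}
    (hC : ∀ n, ψ n ≤ C) {v : β} {c : ℝ} (hc : ∀ᵐ x ∂μ, c ≤ ψ (v - ι x)) :
    c ≤ mixDensity μ ι ψ v := by
  calc c = ∫ _, c ∂μ := by simp
    _ ≤ mixDensity μ ι ψ v :=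
        integral_mono_ae (integrable_const _) (integrable_shift μ hι hψ hpos hC v) hc

/-- Integrability of the log-density of the output, given a lower bound on the channel density. -/
lemma integrable_log_mixDensity {Ω : Type*} [MeasurableSpace Ω] (P : Measure Ω)
    [IsProbabilityMeasure P] {V : Ω → β} (hV : Measurable V)
    (μ : Measure ℝ) [IsProbabilityMeasure μ] {ι : ℝ → β}
    (hι : Measurable ι) {ψ : β → ℝ} (hψ : Measurable ψ) (hpos : ∀ n, 0 < ψ n) {C : ℝ}
    (hC : ∀ n, ψ n ≤ C) {Q : β → ℝ} (hQ : ∀ v, ∀ᵐ x ∂μ, Real.exp (-Q v) ≤ ψ (v - ι x))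
    (hQi : Integrable (fun ω => Q (V ω)) P) :
    Integrable (fun ω => Real.log (mixDensity μ ι ψ (V ω))) P := by
  have hm := measurable_mixDensity μ hι hψ
  refine (hQi.norm.add (integrable_const |Real.log C|)).mono'
    (Measurable.aestronglyMeasurable (by fun_prop)) (ae_of_all _ fun ω => ?_)
  have h1 : -Q (V ω) ≤ Real.log (mixDensity μ ι ψ (V ω)) := by
    rw [Real.le_log_iff_exp_le (mixDensity_pos μ hι hψ hpos hC _)]
    exact le_mixDensity μ hι hψ hpos hC (hQ _)
  have h2 : Real.log (mixDensity μ ι ψ (V ω)) ≤ Real.log C :=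
    Real.log_le_log (mixDensity_pos μ hι hψ hpos hC _) (mixDensity_le μ hι hψ hpos hC _)
  simp only [Pi.add_apply, Real.norm_eq_abs]
  rw [abs_le]
  constructor <;> linarith [le_abs_self (Q (V ω)), le_abs_self (Real.log C),
    abs_nonneg (Q (V ω)), abs_nonneg (Real.log C)]

variable [MeasurableAdd₂ β]

lemma map_input_output (μ : Measure ℝ) [SFinite μ] (ν : Measure β) [SFinite ν]
    [ν.IsAddLeftInvariant] {ι : ℝ → β} (hι : Measurable ι) {ψ : β → ℝ} (hψ : Measurable ψ) :
    (μ.prod (ν.withDensity fun n => ENNReal.ofReal (ψ n))).map (fun p => (p.1, ι p.1 + p.2)) =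
      (μ.prod ν).withDensity (fun p => ENNReal.ofReal (ψ (p.2 - ι p.1))) := by
  have hT : MeasurePreserving (fun p : ℝ × β => (p.1, ι p.1 + p.2)) (μ.prod ν) (μ.prod ν) :=
    (MeasurePreserving.id μ).skew_product (g := fun x n => ι x + n)
      (by unfold Function.uncurry; fun_prop) (ae_of_all _ fun x => map_add_left_eq_self ν (ι x))
  rw [prod_withDensity_right (by fun_prop)]
  ext s hs
  rw [Measure.map_apply hT.measurable hs, withDensity_apply _ (hT.measurable hs),
    withDensity_apply _ hs, ← lintegral_indicator (hT.measurable hs), ← lintegral_indicator hs,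
    ← hT.lintegral_comp ((by fun_prop : Measurable fun p : ℝ × β =>
      ENNReal.ofReal (ψ (p.2 - ι p.1))).indicator hs)]
  refine lintegral_congr fun p => ?_
  simp [Set.indicator]

lemma map_output (μ : Measure ℝ) [IsProbabilityMeasure μ] (ν : Measure β) [SFinite ν]
    [ν.IsAddLeftInvariant] {ι : ℝ → β} (hι : Measurable ι) {ψ : β → ℝ} (hψ : Measurable ψ)
    (hpos : ∀ n, 0 < ψ n) {C : ℝ} (hC : ∀ n, ψ n ≤ C) :
    (μ.prod (ν.withDensity fun n => ENNReal.ofReal (ψ n))).map (fun p => ι p.1 + p.2) =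
      ν.withDensity (fun v => ENNReal.ofReal (mixDensity μ ι ψ v)) := by
  have h : (μ.prod (ν.withDensity fun n => ENNReal.ofReal (ψ n))).map (fun p => ι p.1 + p.2) =
      ((μ.prod (ν.withDensity fun n => ENNReal.ofReal (ψ n))).map
        (fun p => (p.1, ι p.1 + p.2))).map Prod.snd := by
    rw [Measure.map_map (by fun_prop) (by fun_prop)]
    rfl
  rw [h, map_input_output μ ν hι hψ]
  ext s hs
  rw [Measure.map_apply measurable_snd hs, withDensity_apply _ (measurable_snd hs),
    withDensity_apply _ hs, ← Set.univ_prod, ← Measure.prod_restrict, Measure.restrict_univ,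
    lintegral_prod_symm _ (by fun_prop)]
  refine lintegral_congr fun v => ?_
  rw [mixDensity, ofReal_integral_eq_lintegral_ofReal (integrable_shift μ hι hψ hpos hC v)
    (ae_of_all _ fun x => (hpos _).le)]

lemma klDiv_shift (μ : Measure ℝ) [IsProbabilityMeasure μ] (ν : Measure β) [SigmaFinite ν]
    [ν.IsAddLeftInvariant] {ι : ℝ → β} (hι : Measurable ι) {ψ : β → ℝ} (hψ : Measurable ψ)
    (hpos : ∀ n, 0 < ψ n) {C : ℝ} (hC : ∀ n, ψ n ≤ C) {γ : Measure β} [IsProbabilityMeasure γ]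
    (hγ : γ = ν.withDensity fun n => ENNReal.ofReal (ψ n))
    (h₁ : Integrable (fun p : ℝ × β => Real.log (ψ p.2)) (μ.prod γ))
    (h₂ : Integrable (fun p : ℝ × β => Real.log (mixDensity μ ι ψ (ι p.1 + p.2))) (μ.prod γ)) :
    klDiv ((μ.prod γ).map fun p => (p.1, ι p.1 + p.2))
        (μ.prod ((μ.prod γ).map fun p => ι p.1 + p.2)) =
      ((∫ p, Real.log (ψ p.2) ∂(μ.prod γ) -
        ∫ p, Real.log (mixDensity μ ι ψ (ι p.1 + p.2)) ∂(μ.prod γ) : ℝ) : EReal) := by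
  set F := mixDensity μ ι ψ with hF
  have hFm : Measurable F := measurable_mixDensity μ hι hψ
  have hF0 : ∀ v, 0 < F v := mixDensity_pos μ hι hψ hpos hC
  have hTm : Measurable fun p : ℝ × β => (p.1, ι p.1 + p.2) := by fun_prop
  have hprob : IsProbabilityMeasure ((μ.prod γ).map fun p => ι p.1 + p.2) :=
    Measure.isProbabilityMeasure_map (by fun_prop)
  have hJ : (μ.prod γ).map (fun p => (p.1, ι p.1 + p.2)) =
      (μ.prod ((μ.prod γ).map fun p => ι p.1 + p.2)).withDensity
        (fun p => ENNReal.ofReal (ψ (p.2 - ι p.1) / F p.2)) := by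
    subst hγ
    rw [map_input_output μ ν hι hψ, map_output μ ν hι hψ hpos hC, ← hF,
      prod_withDensity_right (by fun_prop), ← withDensity_mul _ (by fun_prop) (by fun_prop)]
    congr 1
    ext p
    rw [Pi.mul_apply, ← ENNReal.ofReal_mul (hF0 _).le, mul_div_cancel₀ _ (hF0 _).ne']
  have hlog : ∀ p : ℝ × β, Real.log (ψ ((p.1, ι p.1 + p.2).2 - ι (p.1, ι p.1 + p.2).1) /
      F (p.1, ι p.1 + p.2).2) = Real.log (ψ p.2) - Real.log (F (ι p.1 + p.2)) := by
    intro p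
    rw [Real.log_div (hpos _).ne' (hF0 _).ne']
    simp
  have hmeas : Measurable fun q : ℝ × β => Real.log (ψ (q.2 - ι q.1) / F q.2) := by fun_prop
  have hint : Integrable (fun q : ℝ × β => Real.log (ψ (q.2 - ι q.1) / F q.2))
      ((μ.prod γ).map fun p => (p.1, ι p.1 + p.2)) := by
    rw [integrable_map_measure hmeas.aestronglyMeasurable hTm.aemeasurable]
    exact (h₁.sub h₂).congr (ae_of_all _ fun p => (hlog p).symm)
  have hval : ∫ q, Real.log (ψ (q.2 - ι q.1) / F q.2)
      ∂((μ.prod γ).map fun p => (p.1, ι p.1 + p.2)) =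
      ∫ p, Real.log (ψ p.2) ∂(μ.prod γ) - ∫ p, Real.log (F (ι p.1 + p.2)) ∂(μ.prod γ) := by
    rw [integral_map hTm.aemeasurable hmeas.aestronglyMeasurable, ← integral_sub h₁ h₂]
    exact integral_congr_ae (ae_of_all _ hlog)
  rw [← hval]
  rw [hJ] at hint ⊢
  exact klDiv_withDensity_of_integrable _ (by fun_prop)
    (fun p => div_nonneg (hpos _).le (hF0 _).le) hint

end ShiftChannel

section Gaussian

lemma log_gaussianPDFReal {v : ℝ≥0} (hv : v ≠ 0) (x : ℝ) :
    Real.log (gaussianPDFReal 0 v x) = -(1 / 2 * Real.log (2 * π * v)) - x ^ 2 / (2 * v) := by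
  have hv' : (0 : ℝ) < v := by positivity
  rw [gaussianPDFReal, Real.log_mul (by positivity) (by positivity), Real.log_exp, Real.log_inv,
    Real.log_sqrt (by positivity)]
  ring

lemma gaussianPDFReal_le (m : ℝ) (v : ℝ≥0) (x : ℝ) :
    gaussianPDFReal m v x ≤ (√(2 * π * v))⁻¹ := by
  rw [gaussianPDFReal]
  refine mul_le_of_le_one_right (by positivity) (Real.exp_le_one_iff.mpr ?_)
  rw [neg_div]
  exact neg_nonpos.mpr (by positivity)

/-- A quadratic upper bound for `-log φ_v (z - x)`, uniform over `|x| ≤ A`. -/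
def gaussianCost (v : ℝ≥0) (A z : ℝ) : ℝ := 1 / 2 * Real.log (2 * π * v) + (z ^ 2 + A ^ 2) / v

lemma exp_neg_gaussianCost_le {v : ℝ≥0} (hv : v ≠ 0) {A x : ℝ} (hx : |x| ≤ A) (z : ℝ) :
    Real.exp (-gaussianCost v A z) ≤ gaussianPDFReal 0 v (z - x) := by
  have hv' : (0 : ℝ) < v := by positivity
  rw [← Real.le_log_iff_exp_le (gaussianPDFReal_pos _ _ _ hv), log_gaussianPDFReal hv,
    gaussianCost]
  have h1 : x ^ 2 ≤ A ^ 2 := sq_le_sq' (by linarith [neg_abs_le x]) (by linarith [le_abs_self x])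
  have h2 : (z - x) ^ 2 / (2 * v) ≤ (z ^ 2 + A ^ 2) / v := by
    rw [div_le_div_iff₀ (by positivity) hv']
    nlinarith [sq_nonneg (z + x)]
  linarith

lemma gaussianPDFReal_mul_gaussianPDFReal {a b : ℝ≥0} (ha : a ≠ 0) (hb : b ≠ 0) (x y z : ℝ) :
    gaussianPDFReal 0 a (y - x) * gaussianPDFReal 0 b (z - x) =
      gaussianPDFReal 0 (a + b) (y - z) *
        gaussianPDFReal ((b * y + a * z) / (a + b)) (a * b / (a + b)) x := by
  have ha' : (0 : ℝ) < a := by positivity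
  have hb' : (0 : ℝ) < b := by positivity
  simp only [gaussianPDFReal, NNReal.coe_add, NNReal.coe_div, NNReal.coe_mul]
  rw [mul_mul_mul_comm, mul_mul_mul_comm (√(2 * π * (a + b)))⁻¹, ← Real.exp_add, ← Real.exp_add,
    ← mul_inv, ← mul_inv, ← Real.sqrt_mul (by positivity), ← Real.sqrt_mul (by positivity)]
  congr 1
  · congr 2
    field_simp
  · congr 1
    field_simp
    ring

lemma integral_sq_gaussianReal (v : ℝ≥0) : ∫ x, x ^ 2 ∂(gaussianReal 0 v) = v := by
  have h := variance_id_gaussianReal (μ := 0) (v := v)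
  rw [variance_of_integral_eq_zero aemeasurable_id (by simp)] at h
  simpa using h

lemma integral_exp_tail_le_one {A t : ℝ} (hA : 0 < A) (ht : 0 < t) :
    ∫⁻ z : ℝ, ENNReal.ofReal
      ((2 * A + 2 * t)⁻¹ * Real.exp (-(max (|z| - A) 0 / t))) ≤ 1 := by
  have hdom : ∀ z : ℝ, ENNReal.ofReal (Real.exp (-(max (|z| - A) 0 / t))) ≤
      (Icc (-A) A).indicator (fun _ => 1) z +
        ((Ioi A).indicator (fun z => ENNReal.ofReal (Real.exp (A / t) * Real.exp (-t⁻¹ * z))) z +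
        (Iic (-A)).indicator
          (fun z => ENNReal.ofReal (Real.exp (A / t) * Real.exp (t⁻¹ * z))) z) := by
    intro z
    rcases lt_or_ge A z with h | h
    · have h1 : z ∈ Ioi A := h
      rw [Set.indicator_of_mem h1]
      refine le_trans ?_ (le_add_left le_self_add)
      refine ENNReal.ofReal_le_ofReal ?_
      rw [← Real.exp_add, abs_of_pos (hA.trans h), max_eq_left (by linarith)]
      refine Real.exp_le_exp.mpr (le_of_eq ?_)
      field_simp
      ring
    rcases le_or_gt z (-A) with hle | hle
    · have h1 : z ∈ Iic (-A) := hle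
      rw [Set.indicator_of_mem h1]
      refine le_trans ?_ (le_add_left le_add_self)
      refine ENNReal.ofReal_le_ofReal ?_
      rw [← Real.exp_add, abs_of_nonpos (by linarith), max_eq_left (by linarith)]
      refine Real.exp_le_exp.mpr (le_of_eq ?_)
      field_simp
      ring
    · have h1 : z ∈ Icc (-A) A := ⟨hle.le, h⟩
      rw [Set.indicator_of_mem h1]
      refine le_trans ?_ le_self_add
      rw [ENNReal.ofReal_le_one, Real.exp_le_one_iff]
      exact neg_nonpos.mpr (div_nonneg (le_max_right _ _) ht.le)
  have hR : ∫⁻ z in Ioi A, ENNReal.ofReal (Real.exp (A / t) * Real.exp (-t⁻¹ * z)) =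
      ENNReal.ofReal t := by
    rw [← ofReal_integral_eq_lintegral_ofReal
      ((integrableOn_exp_mul_Ioi (neg_lt_zero.mpr (inv_pos.mpr ht)) A).const_mul _)
      (ae_of_all _ fun _ => by positivity), integral_const_mul,
      integral_exp_mul_Ioi (neg_lt_zero.mpr (inv_pos.mpr ht))]
    congr 1
    rw [neg_div_neg_eq, mul_div_assoc', ← Real.exp_add]
    have : A / t + -t⁻¹ * A = 0 := by field_simp; ring
    rw [this]
    simp
  have hL : ∫⁻ z in Iic (-A), ENNReal.ofReal (Real.exp (A / t) * Real.exp (t⁻¹ * z)) =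
      ENNReal.ofReal t := by
    rw [← ofReal_integral_eq_lintegral_ofReal
      ((integrableOn_exp_mul_Iic (inv_pos.mpr ht) (-A)).const_mul _)
      (ae_of_all _ fun _ => by positivity), integral_const_mul,
      integral_exp_mul_Iic (inv_pos.mpr ht)]
    congr 1
    rw [mul_div_assoc', ← Real.exp_add]
    have : A / t + t⁻¹ * -A = 0 := by field_simp; ring
    rw [this]
    simp
  have hsum : ∫⁻ z : ℝ, ENNReal.ofReal (Real.exp (-(max (|z| - A) 0 / t))) ≤
      ENNReal.ofReal (2 * A + 2 * t) := by
    refine (lintegral_mono hdom).trans (le_of_eq ?_)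
    rw [lintegral_add_left (measurable_const.indicator measurableSet_Icc),
      lintegral_add_left ((by fun_prop : Measurable fun z =>
        ENNReal.ofReal (Real.exp (A / t) * Real.exp (-t⁻¹ * z))).indicator measurableSet_Ioi),
      lintegral_indicator measurableSet_Icc, lintegral_indicator measurableSet_Ioi,
      lintegral_indicator measurableSet_Iic, hR, hL, setLIntegral_one, Real.volume_Icc,
      ← ENNReal.ofReal_add ht.le ht.le, ← ENNReal.ofReal_add (by linarith) (by linarith)]
    congr 1
    ring
  have hc : 0 < 2 * A + 2 * t := by positivity
  simp_rw [ENNReal.ofReal_mul (inv_nonneg.mpr hc.le)]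
  rw [lintegral_const_mul _ (by fun_prop), ENNReal.ofReal_inv_of_pos hc]
  rw [ENNReal.inv_mul_le_iff (by simpa using hc) ENNReal.ofReal_ne_top, mul_one]
  exact hsum

end Gaussian

section Channel

/-- The joint density of the two noises. -/
def noiseDensity (a b : ℝ≥0) (n : ℝ × ℝ) : ℝ := gaussianPDFReal 0 a n.1 * gaussianPDFReal 0 b n.2

lemma gaussianReal_prod_eq {a b : ℝ≥0} (ha : a ≠ 0) (hb : b ≠ 0) :
    (gaussianReal 0 a).prod (gaussianReal 0 b) =
      (volume : Measure (ℝ × ℝ)).withDensity fun n => ENNReal.ofReal (noiseDensity a b n) := by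
  rw [gaussianReal_of_var_ne_zero _ ha, gaussianReal_of_var_ne_zero _ hb,
    prod_withDensity (by fun_prop) (by fun_prop), Measure.volume_eq_prod]
  congr 1
  ext n
  rw [noiseDensity, ENNReal.ofReal_mul (gaussianPDFReal_nonneg _ _ _)]
  rfl

lemma measurable_noiseDensity (a b : ℝ≥0) : Measurable (noiseDensity a b) := by
  unfold noiseDensity
  fun_prop

lemma noiseDensity_pos {a b : ℝ≥0} (ha : a ≠ 0) (hb : b ≠ 0) (n : ℝ × ℝ) :
    0 < noiseDensity a b n :=
  mul_pos (gaussianPDFReal_pos _ _ _ ha) (gaussianPDFReal_pos _ _ _ hb)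

lemma noiseDensity_le (a b : ℝ≥0) (n : ℝ × ℝ) :
    noiseDensity a b n ≤ (√(2 * π * a))⁻¹ * (√(2 * π * b))⁻¹ :=
  mul_le_mul (gaussianPDFReal_le _ _ _) (gaussianPDFReal_le _ _ _)
    (gaussianPDFReal_nonneg _ _ _) (by positivity)

/-- The density of `Z`. -/
def densZ (μ : Measure ℝ) (b : ℝ≥0) : ℝ → ℝ := mixDensity μ (fun x => x) (gaussianPDFReal 0 b)

/-- The density of `(Y, Z)`. -/
def densYZ (μ : Measure ℝ) (a b : ℝ≥0) : ℝ × ℝ → ℝ :=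
  mixDensity μ (fun x => (x, x)) (noiseDensity a b)

/-- The law of the input together with the two noises, parametrized by the noise variances. -/
def inputNoise (μ : Measure ℝ) (a b : ℝ≥0) : Measure (ℝ × ℝ × ℝ) :=
  μ.prod ((gaussianReal 0 a).prod (gaussianReal 0 b))

instance (μ : Measure ℝ) [IsProbabilityMeasure μ] (a b : ℝ≥0) :
    IsProbabilityMeasure (inputNoise μ a b) := by
  unfold inputNoise
  infer_instance

variable {μ : Measure ℝ} {a b : ℝ≥0} {A : ℝ}

lemma ae_abs_le (hμ : μ (Icc (-A) A)ᶜ = 0) : ∀ᵐ x ∂μ, |x| ≤ A := by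
  rw [← mem_ae_iff] at hμ
  filter_upwards [hμ] with x hx
  exact abs_le.mpr hx

lemma measurePreserving_input : MeasurePreserving (fun ω : ℝ × ℝ × ℝ => ω.1)
    (inputNoise μ a b) μ := measurePreserving_fst

variable [IsProbabilityMeasure μ]

lemma measurePreserving_noiseD : MeasurePreserving (fun ω : ℝ × ℝ × ℝ => ω.2.1)
    (inputNoise μ a b) (gaussianReal 0 a) :=
  measurePreserving_fst.comp measurePreserving_snd

lemma measurePreserving_noiseE : MeasurePreserving (fun ω : ℝ × ℝ × ℝ => ω.2.2)
    (inputNoise μ a b) (gaussianReal 0 b) :=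
  measurePreserving_snd.comp measurePreserving_snd

lemma measurePreserving_input_noiseE : MeasurePreserving (fun ω : ℝ × ℝ × ℝ => (ω.1, ω.2.2))
    (inputNoise μ a b) (μ.prod (gaussianReal 0 b)) :=
  (MeasurePreserving.id μ).prod measurePreserving_snd

lemma memLp_input (hμ : μ (Icc (-A) A)ᶜ = 0) :
    MemLp (fun ω : ℝ × ℝ × ℝ => ω.1) 2 (inputNoise μ a b) := by
  have h : MemLp (fun x : ℝ => x) 2 μ := MemLp.of_bound (by fun_prop) A (ae_abs_le hμ)
  exact h.comp_measurePreserving measurePreserving_input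

lemma memLp_noiseD : MemLp (fun ω : ℝ × ℝ × ℝ => ω.2.1) 2 (inputNoise μ a b) :=
  (memLp_id_gaussianReal 2).comp_measurePreserving measurePreserving_noiseD

lemma memLp_noiseE : MemLp (fun ω : ℝ × ℝ × ℝ => ω.2.2) 2 (inputNoise μ a b) :=
  (memLp_id_gaussianReal 2).comp_measurePreserving measurePreserving_noiseE

lemma memLp_noise_sub :
    MemLp (fun ω : ℝ × ℝ × ℝ => ω.2.1 - ω.2.2) 2 (inputNoise μ a b) :=
  memLp_noiseD.sub memLp_noiseE

lemma integrable_log_gaussianPDFReal {Ω : Type*} [MeasurableSpace Ω] {P : Measure Ω}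
    [IsProbabilityMeasure P] {v : ℝ≥0} (hv : v ≠ 0) {W : Ω → ℝ} (hW : MemLp W 2 P) :
    Integrable (fun ω => Real.log (gaussianPDFReal 0 v (W ω))) P := by
  simp_rw [log_gaussianPDFReal hv]
  exact (integrable_const _).sub (hW.integrable_sq.div_const _)

lemma integral_log_gaussianPDFReal {Ω : Type*} [MeasurableSpace Ω] {P : Measure Ω}
    [IsProbabilityMeasure P] {v : ℝ≥0} (hv : v ≠ 0) {W : Ω → ℝ} (hW : MemLp W 2 P)
    (hvar : ∫ ω, W ω ^ 2 ∂P = v) :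
    ∫ ω, Real.log (gaussianPDFReal 0 v (W ω)) ∂P = -(1 / 2 * Real.log (2 * π * v)) - 1 / 2 := by
  have hv' : (v : ℝ) ≠ 0 := by exact_mod_cast hv
  simp_rw [log_gaussianPDFReal hv]
  rw [integral_sub (integrable_const _) (hW.integrable_sq.div_const _), integral_div, hvar]
  simp only [integral_const, probReal_univ, smul_eq_mul, one_mul]
  congr 1
  field_simp

lemma integrable_gaussianCost {Ω : Type*} [MeasurableSpace Ω] {P : Measure Ω}
    [IsProbabilityMeasure P] (v : ℝ≥0) (A : ℝ) {W : Ω → ℝ} (hW : MemLp W 2 P) :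
    Integrable (fun ω => gaussianCost v A (W ω)) P :=
  (integrable_const _).add ((hW.integrable_sq.add (integrable_const _)).div_const _)

lemma integral_noiseD_sq : ∫ ω, ω.2.1 ^ 2 ∂(inputNoise μ a b) = a := by
  rw [← integral_sq_gaussianReal a, ← (measurePreserving_noiseD (μ := μ) (b := b)).map_eq,
    integral_map measurePreserving_noiseD.aemeasurable (by fun_prop)]

lemma integral_noiseE_sq : ∫ ω, ω.2.2 ^ 2 ∂(inputNoise μ a b) = b := by
  rw [← integral_sq_gaussianReal b, ← (measurePreserving_noiseE (μ := μ) (a := a)).map_eq,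
    integral_map measurePreserving_noiseE.aemeasurable (by fun_prop)]

lemma integral_noiseD_mul_noiseE : ∫ ω, ω.2.1 * ω.2.2 ∂(inputNoise μ a b) = 0 := by
  have h : MeasurePreserving (fun ω : ℝ × ℝ × ℝ => ω.2) (inputNoise μ a b)
    ((gaussianReal 0 a).prod (gaussianReal 0 b)) := measurePreserving_snd
  have h2 : ∫ n, n.1 * n.2 ∂((gaussianReal 0 a).prod (gaussianReal 0 b)) = 0 := by
    rw [integral_prod_mul (fun x : ℝ => x) (fun x : ℝ => x)]
    simp
  rw [← h2, ← h.map_eq, integral_map h.aemeasurable (by fun_prop)]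

lemma integral_noise_sub_sq : ∫ ω, (ω.2.1 - ω.2.2) ^ 2 ∂(inputNoise μ a b) = (a + b : ℝ≥0) := by
  have h : ∀ ω : ℝ × ℝ × ℝ, (ω.2.1 - ω.2.2) ^ 2 =
      ω.2.1 ^ 2 + ω.2.2 ^ 2 - 2 * (ω.2.1 * ω.2.2) := fun ω => by ring
  have hD := (memLp_noiseD (μ := μ) (a := a) (b := b)).integrable_sq
  have hE := (memLp_noiseE (μ := μ) (a := a) (b := b)).integrable_sq
  have hDE : Integrable (fun ω : ℝ × ℝ × ℝ => ω.2.1 * ω.2.2) (inputNoise μ a b) :=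
    memLp_noiseD.integrable_mul memLp_noiseE
  have hsum : Integrable (fun ω : ℝ × ℝ × ℝ => ω.2.1 ^ 2 + ω.2.2 ^ 2) (inputNoise μ a b) :=
    hD.add hE
  simp_rw [h]
  rw [integral_sub hsum (hDE.const_mul 2), integral_add hD hE, integral_const_mul,
    integral_noiseD_sq, integral_noiseE_sq, integral_noiseD_mul_noiseE]
  simp

lemma integrable_log_densZ (hb : b ≠ 0) (hμ : μ (Icc (-A) A)ᶜ = 0) :
    Integrable (fun ω : ℝ × ℝ × ℝ => Real.log (densZ μ b (ω.1 + ω.2.2))) (inputNoise μ a b) := by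
  refine integrable_log_mixDensity (inputNoise μ a b) (V := fun ω => ω.1 + ω.2.2) (by fun_prop) μ
    measurable_id (measurable_gaussianPDFReal 0 b) (fun n => gaussianPDFReal_pos _ _ _ hb)
    (gaussianPDFReal_le 0 b) (Q := gaussianCost b A) ?_
    (integrable_gaussianCost b A ((memLp_input hμ).add memLp_noiseE))
  intro v
  filter_upwards [ae_abs_le hμ] with x hx
  exact exp_neg_gaussianCost_le hb hx v

lemma integrable_log_densYZ (ha : a ≠ 0) (hb : b ≠ 0) (hμ : μ (Icc (-A) A)ᶜ = 0) :
    Integrable (fun ω : ℝ × ℝ × ℝ => Real.log (densYZ μ a b (ω.1 + ω.2.1, ω.1 + ω.2.2)))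
      (inputNoise μ a b) := by
  refine integrable_log_mixDensity (inputNoise μ a b)
    (V := fun ω => (ω.1 + ω.2.1, ω.1 + ω.2.2)) (by fun_prop) μ
    (by fun_prop) (measurable_noiseDensity a b) (noiseDensity_pos ha hb)
    (noiseDensity_le a b) (Q := fun v => gaussianCost a A v.1 + gaussianCost b A v.2) ?_
    ((integrable_gaussianCost a A ((memLp_input hμ).add memLp_noiseD)).add
      (integrable_gaussianCost b A ((memLp_input hμ).add memLp_noiseE)))
  intro v
  filter_upwards [ae_abs_le hμ] with x hx
  rw [neg_add, Real.exp_add]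
  exact mul_le_mul (exp_neg_gaussianCost_le ha hx v.1) (exp_neg_gaussianCost_le hb hx v.2)
    (Real.exp_pos _).le (gaussianPDFReal_nonneg _ _ _)

lemma map_outputZ (hb : b ≠ 0) :
    (inputNoise μ a b).map (fun ω => ω.1 + ω.2.2) =
      volume.withDensity fun z => ENNReal.ofReal (densZ μ b z) := by
  have h : (fun ω : ℝ × ℝ × ℝ => ω.1 + ω.2.2) =
    (fun p : ℝ × ℝ => p.1 + p.2) ∘ fun ω : ℝ × ℝ × ℝ => (ω.1, ω.2.2) := rfl
  rw [h, ← Measure.map_map (by fun_prop) (by fun_prop), measurePreserving_input_noiseE.map_eq,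
    gaussianReal_of_var_ne_zero _ hb]
  exact map_output μ volume (ι := fun x => x) measurable_id (measurable_gaussianPDFReal 0 b)
    (fun n => gaussianPDFReal_pos _ _ _ hb) (gaussianPDFReal_le 0 b)

lemma map_outputYZ (ha : a ≠ 0) (hb : b ≠ 0) :
    (inputNoise μ a b).map (fun ω => (ω.1 + ω.2.1, ω.1 + ω.2.2)) =
      volume.withDensity fun v => ENNReal.ofReal (densYZ μ a b v) := by
  rw [inputNoise, gaussianReal_prod_eq ha hb]
  exact map_output μ volume (ι := fun x => (x, x)) (by fun_prop) (measurable_noiseDensity a b)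
    (noiseDensity_pos ha hb) (noiseDensity_le a b)

lemma mutualInfo_outputZ (hb : b ≠ 0) (hμ : μ (Icc (-A) A)ᶜ = 0) :
    mutualInfo (inputNoise μ a b) Xc Zc =
      ((∫ ω, Real.log (gaussianPDFReal 0 b ω.2.2) ∂(inputNoise μ a b) -
        ∫ ω, Real.log (densZ μ b (ω.1 + ω.2.2)) ∂(inputNoise μ a b) : ℝ) : EReal) := by
  have hmp := measurePreserving_input_noiseE (μ := μ) (a := a) (b := b)
  have hX : (inputNoise μ a b).map Xc = μ := measurePreserving_input.map_eq
  have hZ : (inputNoise μ a b).map Zc = (μ.prod (gaussianReal 0 b)).map fun p => p.1 + p.2 := by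
    rw [← hmp.map_eq, Measure.map_map (by fun_prop) (by fun_prop)]
    rfl
  have hXZ : (inputNoise μ a b).map (fun ω => (Xc ω, Zc ω)) =
      (μ.prod (gaussianReal 0 b)).map fun p => (p.1, p.1 + p.2) := by
    rw [← hmp.map_eq, Measure.map_map (by fun_prop) (by fun_prop)]
    rfl
  have hdm : Measurable (mixDensity μ (fun x => x) (gaussianPDFReal 0 b)) :=
    measurable_mixDensity μ measurable_id (measurable_gaussianPDFReal 0 b)
  have m₁ : AEStronglyMeasurable (fun p : ℝ × ℝ => Real.log (gaussianPDFReal 0 b p.2))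
    (μ.prod (gaussianReal 0 b)) := Measurable.aestronglyMeasurable (by fun_prop)
  have m₂ : AEStronglyMeasurable
    (fun p : ℝ × ℝ => Real.log (mixDensity μ (fun x => x) (gaussianPDFReal 0 b) (p.1 + p.2)))
    (μ.prod (gaussianReal 0 b)) := Measurable.aestronglyMeasurable (by fun_prop)
  rw [mutualInfo, hX, hZ, hXZ]
  rw [klDiv_shift μ volume (ι := fun x => x) measurable_id (measurable_gaussianPDFReal 0 b)
    (fun n => gaussianPDFReal_pos _ _ _ hb) (gaussianPDFReal_le 0 b)
    (gaussianReal_of_var_ne_zero _ hb)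
    ((hmp.integrable_comp m₁).mp (integrable_log_gaussianPDFReal hb memLp_noiseE))
    ((hmp.integrable_comp m₂).mp (integrable_log_densZ hb hμ))]
  congr 2
  · rw [← hmp.map_eq] at m₁ ⊢
    rw [integral_map hmp.aemeasurable m₁]
  · rw [← hmp.map_eq] at m₂ ⊢
    rw [integral_map hmp.aemeasurable m₂]
    rfl

lemma mutualInfo_outputYZ (ha : a ≠ 0) (hb : b ≠ 0) (hμ : μ (Icc (-A) A)ᶜ = 0) :
    mutualInfo (inputNoise μ a b) Xc (fun ω => (Yc ω, Zc ω)) =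
      ((∫ ω, Real.log (gaussianPDFReal 0 a ω.2.1) ∂(inputNoise μ a b) +
        ∫ ω, Real.log (gaussianPDFReal 0 b ω.2.2) ∂(inputNoise μ a b) -
        ∫ ω, Real.log (densYZ μ a b (ω.1 + ω.2.1, ω.1 + ω.2.2)) ∂(inputNoise μ a b) : ℝ)
          : EReal) := by
  have hX : (inputNoise μ a b).map Xc = μ := measurePreserving_input.map_eq
  have hlog : ∀ ω : ℝ × ℝ × ℝ, Real.log (noiseDensity a b ω.2) =
      Real.log (gaussianPDFReal 0 a ω.2.1) + Real.log (gaussianPDFReal 0 b ω.2.2) := fun ω =>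
    Real.log_mul (gaussianPDFReal_pos _ _ _ ha).ne' (gaussianPDFReal_pos _ _ _ hb).ne'
  have hD := integrable_log_gaussianPDFReal ha (memLp_noiseD (μ := μ) (a := a) (b := b))
  have hE := integrable_log_gaussianPDFReal hb (memLp_noiseE (μ := μ) (a := a) (b := b))
  rw [mutualInfo, hX, ← integral_add hD hE, ← integral_congr_ae (ae_of_all _ hlog)]
  exact klDiv_shift μ volume (ι := fun x => (x, x)) (by fun_prop) (measurable_noiseDensity a b)
    (noiseDensity_pos ha hb) (noiseDensity_le a b) (gaussianReal_prod_eq ha hb)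
    ((hD.add hE).congr (ae_of_all _ fun ω => (hlog ω).symm)) (integrable_log_densYZ ha hb hμ)

lemma integral_log_noise_sub_eq (ha : a ≠ 0) :
    ∫ ω, Real.log (gaussianPDFReal 0 a ω.2.1) ∂(inputNoise μ a b) -
      ∫ ω, Real.log (gaussianPDFReal 0 (a + b) (ω.2.1 - ω.2.2)) ∂(inputNoise μ a b) =
      1 / 2 * Real.log (1 + b / a) := by
  have ha' : (0 : ℝ) < a := by positivity
  rw [integral_log_gaussianPDFReal ha memLp_noiseD integral_noiseD_sq,
    integral_log_gaussianPDFReal (by positivity) memLp_noise_sub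
      (integral_noise_sub_sq (μ := μ) (a := a) (b := b))]
  have h : (1 + b / a : ℝ) = (2 * π * (a + b : ℝ≥0)) / (2 * π * a) := by
    push_cast
    field_simp
  rw [h, Real.log_div (by positivity) (by positivity)]
  ring

lemma lintegral_densZ (μ : Measure ℝ) [IsProbabilityMeasure μ] {b : ℝ≥0} (hb : b ≠ 0) :
    ∫⁻ z, ENNReal.ofReal (densZ μ b z) = 1 := by
  have h := map_outputZ (μ := μ) (a := 1) hb
  have h1 : IsProbabilityMeasure
      ((inputNoise μ 1 b).map (fun ω : ℝ × ℝ × ℝ => ω.1 + ω.2.2)) :=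
    Measure.isProbabilityMeasure_map (by fun_prop)
  have h2 := h1.measure_univ
  rwa [h, withDensity_apply _ MeasurableSet.univ, Measure.restrict_univ] at h2

lemma measurable_densZ (μ : Measure ℝ) [IsProbabilityMeasure μ] (b : ℝ≥0) :
    Measurable (densZ μ b) :=
  measurable_mixDensity μ measurable_id (measurable_gaussianPDFReal 0 b)

lemma densZ_pos (μ : Measure ℝ) [IsProbabilityMeasure μ] {b : ℝ≥0} (hb : b ≠ 0) (z : ℝ) :
    0 < densZ μ b z :=
  mixDensity_pos μ measurable_id (measurable_gaussianPDFReal 0 b)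
    (fun _ => gaussianPDFReal_pos _ _ _ hb) (gaussianPDFReal_le 0 b) z

lemma measurable_densYZ (μ : Measure ℝ) [IsProbabilityMeasure μ] (a b : ℝ≥0) :
    Measurable (densYZ μ a b) :=
  measurable_mixDensity μ (by fun_prop) (measurable_noiseDensity a b)

lemma densYZ_pos (μ : Measure ℝ) [IsProbabilityMeasure μ] {a b : ℝ≥0} (ha : a ≠ 0) (hb : b ≠ 0)
    (v : ℝ × ℝ) : 0 < densYZ μ a b v :=
  mixDensity_pos μ (by fun_prop) (measurable_noiseDensity a b)
    (noiseDensity_pos ha hb) (noiseDensity_le a b) v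

/-- `h(Y | Z)` is at most the entropy of the centred Gaussian of variance `a + b`. -/
lemma integral_log_densZ_add_le (ha : a ≠ 0) (hb : b ≠ 0) (hμ : μ (Icc (-A) A)ᶜ = 0) :
    ∫ ω, Real.log (densZ μ b (ω.1 + ω.2.2)) ∂(inputNoise μ a b) +
        ∫ ω, Real.log (gaussianPDFReal 0 (a + b) (ω.2.1 - ω.2.2)) ∂(inputNoise μ a b) ≤
      ∫ ω, Real.log (densYZ μ a b (ω.1 + ω.2.1, ω.1 + ω.2.2)) ∂(inputNoise μ a b) := by
  have hab : a + b ≠ 0 := by positivity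
  have hZm := measurable_densZ μ b
  have hS := integrable_log_gaussianPDFReal hab
    (memLp_noise_sub (μ := μ) (a := a) (b := b))
  have hZ := integrable_log_densZ (a := a) hb hμ
  have hlog : ∀ ω : ℝ × ℝ × ℝ, Real.log (densZ μ b (ω.1 + ω.2.2) *
      gaussianPDFReal 0 (a + b) ((ω.1 + ω.2.1) - (ω.1 + ω.2.2))) =
      Real.log (densZ μ b (ω.1 + ω.2.2)) +
        Real.log (gaussianPDFReal 0 (a + b) (ω.2.1 - ω.2.2)) := by
    intro ω
    rw [add_sub_add_left_eq_sub]
    exact Real.log_mul (densZ_pos μ hb _).ne' (gaussianPDFReal_pos _ _ _ hab).ne'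
  have hone : ∫⁻ v : ℝ × ℝ, ENNReal.ofReal
      (densZ μ b v.2 * gaussianPDFReal 0 (a + b) (v.1 - v.2)) ≤ 1 := by
    rw [Measure.volume_eq_prod, lintegral_prod_symm _ (by fun_prop)]
    simp_rw [ENNReal.ofReal_mul (densZ_pos μ hb _).le]
    rw [← lintegral_densZ μ hb]
    refine lintegral_mono fun z => le_of_eq ?_
    rw [lintegral_const_mul _ (by fun_prop),
      lintegral_sub_right_eq_self (fun y => ENNReal.ofReal (gaussianPDFReal 0 (a + b) y)) z,
      lintegral_gaussianPDFReal_eq_one 0 hab, mul_one]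
  rw [← integral_add hZ hS, ← integral_congr_ae (ae_of_all _ hlog)]
  exact integral_log_le_of_lintegral_le_one (inputNoise μ a b) volume
    (V := fun ω => (ω.1 + ω.2.1, ω.1 + ω.2.2)) (by fun_prop)
    (g := fun v => densZ μ b v.2 * gaussianPDFReal 0 (a + b) (v.1 - v.2))
    (measurable_densYZ μ a b) (by fun_prop) (densYZ_pos μ ha hb)
    (fun v => mul_pos (densZ_pos μ hb _) (gaussianPDFReal_pos _ _ _ hab))
    (map_outputYZ ha hb) hone (integrable_log_densYZ ha hb hμ)
    ((hZ.add hS).congr (ae_of_all _ fun ω => (hlog ω).symm))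

/-- A lower bound for `E log f_Z(Z)` when the input has amplitude at most `A`. -/
lemma le_integral_log_densZ (hb : b ≠ 0) (hA : 0 < A) (hμ : μ (Icc (-A) A)ᶜ = 0) {t : ℝ}
    (ht : 0 < t) :
    -Real.log (2 * A + 2 * t) - (1 + b) / t ≤
      ∫ ω, Real.log (densZ μ b (ω.1 + ω.2.2)) ∂(inputNoise μ a b) := by
  have hc : 0 < 2 * A + 2 * t := by positivity
  have hlog : ∀ z : ℝ, Real.log ((2 * A + 2 * t)⁻¹ * Real.exp (-(max (|z| - A) 0 / t))) =
      -Real.log (2 * A + 2 * t) - max (|z| - A) 0 / t := by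
    intro z
    rw [Real.log_mul (by positivity) (Real.exp_pos _).ne', Real.log_exp, Real.log_inv]
    ring
  have hE : Integrable (fun ω : ℝ × ℝ × ℝ => 1 + ω.2.2 ^ 2) (inputNoise μ a b) :=
    (integrable_const _).add memLp_noiseE.integrable_sq
  have hbound : ∀ᵐ ω ∂(inputNoise μ a b), max (|ω.1 + ω.2.2| - A) 0 ≤ 1 + ω.2.2 ^ 2 := by
    filter_upwards [measurePreserving_input.quasiMeasurePreserving.ae (ae_abs_le hμ)] with ω hω
    refine max_le ?_ (by positivity)
    have h1 := abs_add_le ω.1 ω.2.2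
    nlinarith [sq_abs ω.2.2, sq_nonneg (|ω.2.2| - 1), abs_nonneg ω.2.2]
  have hmax : Integrable (fun ω : ℝ × ℝ × ℝ => max (|ω.1 + ω.2.2| - A) 0) (inputNoise μ a b) := by
    refine hE.mono' (Measurable.aestronglyMeasurable (by fun_prop)) ?_
    filter_upwards [hbound] with ω hω
    rwa [Real.norm_of_nonneg (le_max_right _ _)]
  have hgi : Integrable (fun ω : ℝ × ℝ × ℝ =>
      -Real.log (2 * A + 2 * t) - max (|ω.1 + ω.2.2| - A) 0 / t) (inputNoise μ a b) :=
    (integrable_const _).sub (hmax.div_const t)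
  have hmean : ∫ ω, max (|ω.1 + ω.2.2| - A) 0 ∂(inputNoise μ a b) ≤ 1 + b := by
    refine (integral_mono_ae hmax hE hbound).trans (le_of_eq ?_)
    rw [integral_add (integrable_const _) memLp_noiseE.integrable_sq, integral_noiseE_sq]
    simp
  calc -Real.log (2 * A + 2 * t) - (1 + b) / t
      ≤ -Real.log (2 * A + 2 * t) -
          (∫ ω, max (|ω.1 + ω.2.2| - A) 0 ∂(inputNoise μ a b)) / t := by gcongr
    _ = ∫ ω, (-Real.log (2 * A + 2 * t) - max (|ω.1 + ω.2.2| - A) 0 / t)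
          ∂(inputNoise μ a b) := by
        rw [integral_sub (integrable_const _) (hmax.div_const t), integral_div]
        simp
    _ = ∫ ω, Real.log ((2 * A + 2 * t)⁻¹ * Real.exp (-(max (|ω.1 + ω.2.2| - A) 0 / t)))
          ∂(inputNoise μ a b) := by simp_rw [hlog]
    _ ≤ _ := integral_log_le_of_lintegral_le_one (inputNoise μ a b) volume
        (V := fun ω => ω.1 + ω.2.2) (by fun_prop)
        (g := fun z => (2 * A + 2 * t)⁻¹ * Real.exp (-(max (|z| - A) 0 / t)))
        (measurable_densZ μ b) (by fun_prop) (densZ_pos μ hb) (fun z => by positivity)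
        (map_outputZ hb) (integral_exp_tail_le_one hA ht) (integrable_log_densZ hb hμ)
        (by simpa only [hlog] using hgi)

end Channel

section Uniform

/-- The uniform law on `[-A, A]`. -/
def uniformInput (A : ℝ) : Measure ℝ :=
  (ENNReal.ofReal (2 * A))⁻¹ • (volume.restrict (Icc (-A) A))

lemma isProbabilityMeasure_uniformInput {A : ℝ} (hA : 0 < A) :
    IsProbabilityMeasure (uniformInput A) := by
  refine ⟨?_⟩
  have h : A - -A = 2 * A := by ring
  rw [uniformInput, Measure.smul_apply, Measure.restrict_apply_univ, Real.volume_Icc, h,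
    smul_eq_mul]
  exact ENNReal.inv_mul_cancel (by simpa using hA) ENNReal.ofReal_ne_top

lemma uniformInput_compl (A : ℝ) : uniformInput A (Icc (-A) A)ᶜ = 0 := by
  rw [uniformInput, Measure.smul_apply, Measure.restrict_apply measurableSet_Icc.compl]
  simp

lemma densYZ_uniformInput_le {A : ℝ} (hA : 0 < A) {a b : ℝ≥0} (ha : a ≠ 0) (hb : b ≠ 0)
    (v : ℝ × ℝ) :
    densYZ (uniformInput A) a b v ≤ (2 * A)⁻¹ * gaussianPDFReal 0 (a + b) (v.1 - v.2) := by
  have hv : a * b / (a + b) ≠ 0 := by positivity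
  have h : ∀ x, noiseDensity a b (v - (x, x)) = gaussianPDFReal 0 (a + b) (v.1 - v.2) *
      gaussianPDFReal ((b * v.1 + a * v.2) / (a + b)) (a * b / (a + b)) x := fun x =>
    gaussianPDFReal_mul_gaussianPDFReal ha hb x v.1 v.2
  rw [densYZ, mixDensity, uniformInput, integral_smul_measure, ENNReal.toReal_inv,
    ENNReal.toReal_ofReal (by positivity), smul_eq_mul]
  simp_rw [h]
  rw [integral_const_mul]
  have h1 := setIntegral_le_integral (s := Icc (-A) A)
    (integrable_gaussianPDFReal ((b * v.1 + a * v.2) / (a + b)) (a * b / (a + b)))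
    (ae_of_all _ (gaussianPDFReal_nonneg _ _))
  rw [integral_gaussianPDFReal_eq_one _ hv] at h1
  have h2 := gaussianPDFReal_nonneg 0 (a + b) (v.1 - v.2)
  gcongr
  exact mul_le_of_le_one_right h2 h1

lemma integral_log_densYZ_uniformInput_le {A : ℝ} (hA : 0 < A) {a b : ℝ≥0} (ha : a ≠ 0)
    (hb : b ≠ 0) :
    ∫ ω, Real.log (densYZ (uniformInput A) a b (ω.1 + ω.2.1, ω.1 + ω.2.2))
        ∂(inputNoise (uniformInput A) a b) ≤
      -Real.log (2 * A) + ∫ ω, Real.log (gaussianPDFReal 0 (a + b) (ω.2.1 - ω.2.2))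
        ∂(inputNoise (uniformInput A) a b) := by
  have := isProbabilityMeasure_uniformInput hA
  have hab : a + b ≠ 0 := by positivity
  have hS := integrable_log_gaussianPDFReal hab
    (memLp_noise_sub (μ := uniformInput A) (a := a) (b := b))
  have hconst : -Real.log (2 * A) =
    ∫ _, -Real.log (2 * A) ∂(inputNoise (uniformInput A) a b) := by simp
  rw [hconst, ← integral_add (integrable_const _) hS]
  refine integral_mono (integrable_log_densYZ ha hb (uniformInput_compl A))
    ((integrable_const _).add hS) fun ω => ?_
  have h := Real.log_le_log (densYZ_pos (uniformInput A) ha hb _)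
    (densYZ_uniformInput_le hA ha hb (ω.1 + ω.2.1, ω.1 + ω.2.2))
  rwa [Real.log_mul (by positivity) (gaussianPDFReal_pos _ _ _ hab).ne', Real.log_inv,
    add_sub_add_left_eq_sub] at h

end Uniform

lemma skRate_eq {σD σE : ℝ} (hσD : 0 < σD) (hσE : 0 < σE) {μ : Measure ℝ}
    [IsProbabilityMeasure μ] {A : ℝ} (hμ : μ (Icc (-A) A)ᶜ = 0) {a b : ℝ≥0}
    (ha : a = (σD ^ 2).toNNReal) (hb : b = (σE ^ 2).toNNReal) :
    skRate σD σE μ =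
      ((∫ ω, Real.log (gaussianPDFReal 0 a ω.2.1) ∂(inputNoise μ a b) -
        ∫ ω, Real.log (densYZ μ a b (ω.1 + ω.2.1, ω.1 + ω.2.2)) ∂(inputNoise μ a b) +
        ∫ ω, Real.log (densZ μ b (ω.1 + ω.2.2)) ∂(inputNoise μ a b) : ℝ) : EReal) := by
  have ha0 : a ≠ 0 := by
    rw [ha]
    exact (Real.toNNReal_pos.mpr (by positivity)).ne'
  have hb0 : b ≠ 0 := by
    rw [hb]
    exact (Real.toNNReal_pos.mpr (by positivity)).ne'
  have hchan : chan μ σD σE = inputNoise μ a b := by rw [ha, hb]; rfl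
  rw [skRate, hchan, mutualInfo_outputYZ ha0 hb0 hμ, mutualInfo_outputZ hb0 hμ, ← EReal.coe_sub]
  congr 1
  ring

lemma Ck_le {σD σE : ℝ} (hσD : 0 < σD) (hσE : 0 < σE) (A : ℝ) :
    Ck σD σE A ≤ ((1 / 2 * Real.log (1 + σE ^ 2 / σD ^ 2) : ℝ) : EReal) := by
  refine sSup_le ?_
  rintro r ⟨μ, hprob, hμ, rfl⟩
  have ha0 : (σD ^ 2).toNNReal ≠ 0 := (Real.toNNReal_pos.mpr (by positivity)).ne'
  have hb0 : (σE ^ 2).toNNReal ≠ 0 := (Real.toNNReal_pos.mpr (by positivity)).ne'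
  rw [skRate_eq hσD hσE hμ rfl rfl, EReal.coe_le_coe_iff]
  have h1 := integral_log_noise_sub_eq (μ := μ) (b := (σE ^ 2).toNNReal) ha0
  have h2 := integral_log_densZ_add_le ha0 hb0 hμ
  rw [Real.coe_toNNReal _ (sq_nonneg σD), Real.coe_toNNReal _ (sq_nonneg σE)] at h1
  linarith

lemma le_Ck {σD σE A : ℝ} (hσD : 0 < σD) (hσE : 0 < σE) (hA : 0 < A) :
    ((1 / 2 * Real.log (1 + σE ^ 2 / σD ^ 2) - Real.log (1 + (√A)⁻¹) - (1 + σE ^ 2) * (√A)⁻¹ : ℝ)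
      : EReal) ≤ Ck σD σE A := by
  have hprob := isProbabilityMeasure_uniformInput hA
  have hμ := uniformInput_compl A
  refine le_sSup_of_le ⟨uniformInput A, hprob, hμ, rfl⟩ ?_
  have ha0 : (σD ^ 2).toNNReal ≠ 0 := (Real.toNNReal_pos.mpr (by positivity)).ne'
  have hb0 : (σE ^ 2).toNNReal ≠ 0 := (Real.toNNReal_pos.mpr (by positivity)).ne'
  have ht : 0 < √A := Real.sqrt_pos.mpr hA
  rw [skRate_eq hσD hσE hμ rfl rfl, EReal.coe_le_coe_iff]
  have h1 := integral_log_noise_sub_eq (μ := uniformInput A) (b := (σE ^ 2).toNNReal) ha0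
  have h2 := integral_log_densYZ_uniformInput_le hA ha0 hb0
  have h3 := le_integral_log_densZ (a := (σD ^ 2).toNNReal) hb0 hA hμ ht
  rw [Real.coe_toNNReal _ (sq_nonneg σD), Real.coe_toNNReal _ (sq_nonneg σE)] at h1
  rw [Real.coe_toNNReal _ (sq_nonneg σE), div_eq_mul_inv] at h3
  have h4 : 2 * A + 2 * √A = 2 * A * (1 + (√A)⁻¹) := by
    have h5 : A * (√A)⁻¹ = √A := by
      rw [← div_eq_mul_inv, Real.div_sqrt]
    linear_combination (-2) * h5
  rw [h4, Real.log_mul (by positivity) (by positivity)] at h3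
  linarith

/-- As `A → ∞`, the secret-key capacity with amplitude constraint `A` converges to the
secret-key capacity with an average power constraint, `(1/2) ln(1 + σ_E²/σ_D²)`. -/
theorem stmt6 (σD σE : ℝ) (hσD : 0 < σD) (hσE : 0 < σE) :
    Tendsto (fun A => Ck σD σE A) atTop
      (nhds ((1 / 2 * Real.log (1 + σE ^ 2 / σD ^ 2) : ℝ) : EReal)) := by
  have hinv : Tendsto (fun A : ℝ => (√A)⁻¹) atTop (nhds 0) :=
    tendsto_inv_atTop_zero.comp Real.tendsto_sqrt_atTop
  have hlow : Tendsto (fun A : ℝ => 1 / 2 * Real.log (1 + σE ^ 2 / σD ^ 2) -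
      Real.log (1 + (√A)⁻¹) - (1 + σE ^ 2) * (√A)⁻¹) atTop
      (nhds (1 / 2 * Real.log (1 + σE ^ 2 / σD ^ 2))) := by
    have hlog : Tendsto (fun A : ℝ => Real.log (1 + (√A)⁻¹)) atTop (nhds (Real.log (1 + 0))) :=
      (hinv.const_add 1).log (by norm_num)
    simpa using (hlog.const_sub (1 / 2 * Real.log (1 + σE ^ 2 / σD ^ 2))).sub
      (hinv.const_mul (1 + σE ^ 2))
  refine tendsto_of_tendsto_of_tendsto_of_le_of_le'
    ((continuous_coe_real_ereal.tendsto _).comp hlow) tendsto_const_nhds ?_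
    (Eventually.of_forall fun A => Ck_le hσD hσE A)
  filter_upwards [eventually_gt_atTop 0] with A hA
  exact le_Ck hσD hσE hA

end
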